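/- Let 0<β<∞, let u be holomorphic on 𝔻 and φ a holomorphic self-map of 𝔻, and suppose uC_φ maps the Bloch space B = B^1 boundedly into H^∞_{ν_β}. Then there exist constants c, C > 0 depending only on β (not on u and φ) such that c · limsup_{n→∞} (log n) ‖u·φ^n‖_{ν_β} ≤ ‖uC_φ‖_e ≤ C · limsup_{n→∞} (log n) ‖u·φ^n‖_{ν_β}, where ‖uC_φ‖_e is the essential norm of uC_φ : B → H^∞_{ν_β}. -/

import Mathlib

open Complex Filter Set

noncomputable section

/-- The open unit disk in `ℂ`. -/
def unitDisk : Set ℂ := Metric.ball 0 1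

/-- The weighted sup-norm `‖g‖_{ν_γ} = sup_{z ∈ 𝔻} (1-|z|²)^γ |g(z)|`. -/
def wnorm (γ : ℝ) (g : ℂ → ℂ) : ℝ :=
  sSup ((fun z => (1 - ‖z‖ ^ 2) ^ γ * ‖g z‖) '' unitDisk)

/-- Membership in the weighted Banach space `H^∞_{ν_β}`. -/
def MemWeighted (β : ℝ) (g : ℂ → ℂ) : Prop :=
  DifferentiableOn ℂ g unitDisk ∧
    BddAbove ((fun z => (1 - ‖z‖ ^ 2) ^ β * ‖g z‖) '' unitDisk)

/-- Membership in the Bloch type space `B^α`. -/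
def MemBloch (α : ℝ) (f : ℂ → ℂ) : Prop :=
  DifferentiableOn ℂ f unitDisk ∧
    BddAbove ((fun z => (1 - ‖z‖ ^ 2) ^ α * ‖deriv f z‖) '' unitDisk)

/-- The Bloch type norm `‖f‖_{B^α} = |f(0)| + sup_{z∈𝔻}(1-|z|²)^α |f'(z)|`. -/
def blochNorm (α : ℝ) (f : ℂ → ℂ) : ℝ :=
  ‖f 0‖ + wnorm α (deriv f)

/-- Membership in the Zygmund type space `Z_β`. -/
def MemZygmund (β : ℝ) (f : ℂ → ℂ) : Prop :=
  DifferentiableOn ℂ f unitDisk ∧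
    BddAbove ((fun z => (1 - ‖z‖ ^ 2) ^ β * ‖deriv (deriv f) z‖) '' unitDisk)

/-- The Zygmund type norm `‖f‖_{Z_β} = |f(0)| + |f'(0)| + sup_{z∈𝔻}(1-|z|²)^β |f''(z)|`. -/
def zygNorm (β : ℝ) (f : ℂ → ℂ) : ℝ :=
  ‖f 0‖ + ‖deriv f 0‖ + wnorm β (deriv (deriv f))

/-- The weighted composition operator `uC_φ f = u · (f ∘ φ)`. -/
def wcomp (u φ f : ℂ → ℂ) : ℂ → ℂ := fun z => u z * f (φ z)

/-- `uC_φ` maps `B^α` boundedly into `Z_β`. -/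
def BoundedBlochToZygmund (α β : ℝ) (u φ : ℂ → ℂ) : Prop :=
  (∀ f, MemBloch α f → MemZygmund β (wcomp u φ f)) ∧
    ∃ C > 0, ∀ f, MemBloch α f → zygNorm β (wcomp u φ f) ≤ C * blochNorm α f

/-- `uC_φ` maps `B^α` boundedly into `H^∞_{ν_β}`. -/
def BoundedBlochToWeighted (α β : ℝ) (u φ : ℂ → ℂ) : Prop :=
  (∀ f, MemBloch α f → MemWeighted β (wcomp u φ f)) ∧
    ∃ C > 0, ∀ f, MemBloch α f → wnorm β (wcomp u φ f) ≤ C * blochNorm α f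

/-- `uC_φ : B^α → Z_β` is compact: it is bounded and maps bounded sets of `B^α` to
totally bounded (equivalently, since `Z_β` is complete, relatively compact) subsets
of `Z_β`. -/
def CompactBlochToZygmund (α β : ℝ) (u φ : ℂ → ℂ) : Prop :=
  BoundedBlochToZygmund α β u φ ∧
    ∀ r : ℝ, ∀ ε : ℝ, 0 < ε → ∃ T : Finset (ℂ → ℂ),
      (∀ g ∈ T, MemZygmund β g) ∧
      ∀ f, MemBloch α f → blochNorm α f ≤ r →
        ∃ g ∈ T, zygNorm β (fun z => wcomp u φ f z - g z) ≤ ε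

/-- `uC_φ : B^α → H^∞_{ν_β}` is compact: it is bounded and maps bounded sets of `B^α`
to totally bounded (equivalently, relatively compact) subsets of `H^∞_{ν_β}`. -/
def CompactBlochToWeighted (α β : ℝ) (u φ : ℂ → ℂ) : Prop :=
  BoundedBlochToWeighted α β u φ ∧
    ∀ r : ℝ, ∀ ε : ℝ, 0 < ε → ∃ T : Finset (ℂ → ℂ),
      (∀ g ∈ T, MemWeighted β g) ∧
      ∀ f, MemBloch α f → blochNorm α f ≤ r →
        ∃ g ∈ T, wnorm β (fun z => wcomp u φ f z - g z) ≤ ε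

/-- A compact (linear, bounded, with totally bounded image of the unit ball) operator
from the subspace of `B^α` cut out by the predicate `P` into `Z_β`. -/
def IsCompactOpToZygmund (α β : ℝ) (P : (ℂ → ℂ) → Prop) (K : (ℂ → ℂ) → ℂ → ℂ) : Prop :=
  (∀ f g, P f → P g → ∀ a b : ℂ,
      K (fun z => a * f z + b * g z) = fun z => a * K f z + b * K g z) ∧
  (∀ f, P f → MemZygmund β (K f)) ∧
  (∃ C, ∀ f, P f → zygNorm β (K f) ≤ C * blochNorm α f) ∧
  (∀ ε : ℝ, 0 < ε → ∃ T : Finset (ℂ → ℂ), (∀ g ∈ T, MemZygmund β g) ∧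
      ∀ f, P f → blochNorm α f ≤ 1 → ∃ g ∈ T, zygNorm β (fun z => K f z - g z) ≤ ε)

/-- The essential norm of `uC_φ`, as an operator from the subspace of `B^α` cut out by
the predicate `P` into `Z_β`: the distance to the compact operators, the operator norm
being the supremum over the unit ball. -/
def essNormZ (α β : ℝ) (P : (ℂ → ℂ) → Prop) (u φ : ℂ → ℂ) : ℝ :=
  sInf {r | ∃ K, IsCompactOpToZygmund α β P K ∧
    r = sSup {s | ∃ f, P f ∧ blochNorm α f ≤ 1 ∧
          s = zygNorm β (fun z => wcomp u φ f z - K f z)}}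

/-- A compact (linear, bounded, with totally bounded image of the unit ball) operator
from `B^α` into `H^∞_{ν_β}`. -/
def IsCompactOpToWeighted (α β : ℝ) (K : (ℂ → ℂ) → ℂ → ℂ) : Prop :=
  (∀ f g, MemBloch α f → MemBloch α g → ∀ a b : ℂ,
      K (fun z => a * f z + b * g z) = fun z => a * K f z + b * K g z) ∧
  (∀ f, MemBloch α f → MemWeighted β (K f)) ∧
  (∃ C, ∀ f, MemBloch α f → wnorm β (K f) ≤ C * blochNorm α f) ∧
  (∀ ε : ℝ, 0 < ε → ∃ T : Finset (ℂ → ℂ), (∀ g ∈ T, MemWeighted β g) ∧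
      ∀ f, MemBloch α f → blochNorm α f ≤ 1 → ∃ g ∈ T, wnorm β (fun z => K f z - g z) ≤ ε)

/-- The essential norm of `uC_φ : B^α → H^∞_{ν_β}`. -/
def essNormW (α β : ℝ) (u φ : ℂ → ℂ) : ℝ :=
  sInf {r | ∃ K, IsCompactOpToWeighted α β K ∧
    r = sSup {s | ∃ f, MemBloch α f ∧ blochNorm α f ≤ 1 ∧
          s = wnorm β (fun z => wcomp u φ f z - K f z)}}

/-- `limsup_{|φ(z)|→1} F(z) = lim_{s→1⁻} sup {F z : z ∈ 𝔻, |φ z| > s}`.  Since the inner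
supremum is nonincreasing in `s`, the limit equals the infimum over `s ∈ [0,1)`; note
that `Real.sSup ∅ = 0`, matching the convention that the value is `0` when
`{z : |φ z| > s}` is empty for some `s < 1`. -/
def phiLimsup (φ : ℂ → ℂ) (F : ℂ → ℝ) : ℝ :=
  sInf ((fun s => sSup {y | ∃ z ∈ unitDisk, s < ‖φ z‖ ∧ y = F z}) '' Set.Ico (0:ℝ) 1)

lemma le_wnorm {β : ℝ} {g : ℂ → ℂ} (hg : MemWeighted β g) {z : ℂ} (hz : z ∈ unitDisk) :
    (1 - ‖z‖ ^ 2) ^ β * ‖g z‖ ≤ wnorm β g :=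
  le_csSup hg.2 ⟨z, hz, rfl⟩

lemma wnorm_le {β : ℝ} {g : ℂ → ℂ} {C : ℝ}
    (h : ∀ z ∈ unitDisk, (1 - ‖z‖ ^ 2) ^ β * ‖g z‖ ≤ C) : wnorm β g ≤ C := by
  refine csSup_le ⟨_, 0, by simp [unitDisk], rfl⟩ ?_
  rintro _ ⟨z, hz, rfl⟩
  exact h z hz

lemma norm_lt_one_of_mem {z : ℂ} (hz : z ∈ unitDisk) : ‖z‖ < 1 := by
  simpa [unitDisk] using hz

lemma one_sub_sq_pos {r : ℝ} (h0 : 0 ≤ r) (h1 : r < 1) : 0 < 1 - r ^ 2 := by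
  nlinarith

lemma weight_nonneg (β : ℝ) {z : ℂ} (hz : z ∈ unitDisk) : 0 ≤ (1 - ‖z‖ ^ 2) ^ β :=
  Real.rpow_nonneg (one_sub_sq_pos (norm_nonneg z) (norm_lt_one_of_mem hz)).le _

lemma wnorm_nonneg (β : ℝ) (g : ℂ → ℂ) : 0 ≤ wnorm β g := by
  refine Real.sSup_nonneg ?_
  rintro _ ⟨z, hz, rfl⟩
  exact mul_nonneg (weight_nonneg β hz) (norm_nonneg _)

lemma MemBloch.differentiableAt {α : ℝ} {f : ℂ → ℂ} (hf : MemBloch α f) {z : ℂ}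
    (hz : z ∈ unitDisk) : DifferentiableAt ℂ f z :=
  hf.1.differentiableAt (Metric.isOpen_ball.mem_nhds hz)

lemma memBloch_and_blochNorm_le {f : ℂ → ℂ} {C : ℝ} (hf : DifferentiableOn ℂ f unitDisk)
    (h : ∀ z ∈ unitDisk, (1 - ‖z‖ ^ 2) * ‖deriv f z‖ ≤ C) :
    MemBloch 1 f ∧ blochNorm 1 f ≤ ‖f 0‖ + C := by
  refine ⟨⟨hf, C, ?_⟩, ?_⟩
  · rintro _ ⟨z, hz, rfl⟩
    simpa using h z hz
  · exact add_le_add le_rfl (wnorm_le fun z hz => by simpa using h z hz)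

lemma MemBloch.weight_mul_deriv_le {f : ℂ → ℂ} (hf : MemBloch 1 f) {z : ℂ} (hz : z ∈ unitDisk) :
    (1 - ‖z‖ ^ 2) * ‖deriv f z‖ ≤ wnorm 1 (deriv f) := by
  have := le_csSup hf.2 ⟨z, hz, rfl⟩
  simpa [wnorm] using this

lemma MemBloch.weight_mul_deriv_le_one {f : ℂ → ℂ} (hf : MemBloch 1 f)
    (h1 : blochNorm 1 f ≤ 1) {z : ℂ} (hz : z ∈ unitDisk) :
    (1 - ‖z‖ ^ 2) * ‖deriv f z‖ ≤ 1 := by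
  have := hf.weight_mul_deriv_le hz
  have h2 := norm_nonneg (f 0)
  unfold blochNorm at h1
  linarith

lemma MemBloch.norm_deriv_le {f : ℂ → ℂ} (hf : MemBloch 1 f)
    (h1 : blochNorm 1 f ≤ 1) {z : ℂ} (hz : z ∈ unitDisk) :
    ‖deriv f z‖ ≤ 1 / (1 - ‖z‖) := by
  have h := hf.weight_mul_deriv_le_one h1 hz
  have hz1 := norm_lt_one_of_mem hz
  rw [le_div_iff₀ (by linarith)]
  refine le_trans ?_ h
  rw [mul_comm]
  refine mul_le_mul_of_nonneg_right ?_ (norm_nonneg _)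
  nlinarith [norm_nonneg z]

lemma MemBloch.norm_zero_le {f : ℂ → ℂ} (h1 : blochNorm 1 f ≤ 1) : ‖f 0‖ ≤ 1 := by
  have := wnorm_nonneg 1 (deriv f)
  unfold blochNorm at h1
  linarith

/-- Growth estimate for Bloch functions along a radius. -/
lemma MemBloch.norm_sub_le {f : ℂ → ℂ} (hf : MemBloch 1 f) (h1 : blochNorm 1 f ≤ 1)
    {w : ℂ} (hw : w ∈ unitDisk) {s : ℝ} (hs0 : 0 ≤ s) (hs1 : s ≤ 1) :
    ‖f w - f (s * w)‖ ≤ Real.log (1 - s * ‖w‖) - Real.log (1 - ‖w‖) := by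
  have hw1 := norm_lt_one_of_mem hw
  have hw0 := norm_nonneg w
  have hmem : ∀ t : ℝ, 0 ≤ t → t ≤ 1 → (t : ℂ) * w ∈ unitDisk ∧ ‖(t : ℂ) * w‖ = t * ‖w‖ := by
    intro t ht0 ht1
    have e : ‖(t : ℂ) * w‖ = t * ‖w‖ := by simp [abs_of_nonneg ht0]
    refine ⟨?_, e⟩
    simp only [unitDisk, Metric.mem_ball, dist_zero_right, e]
    nlinarith
  have hg : ∀ t ∈ Icc s 1, HasDerivAt (fun t : ℝ => f (t * w) - f (s * w))
      (deriv f (t * w) * w) t := by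
    intro t ht
    have hd := (hf.differentiableAt (hmem t (hs0.trans ht.1) ht.2).1).hasDerivAt
    have hl : HasDerivAt (fun t : ℝ => (t : ℂ) * w) w t := by
      simpa using (Complex.ofRealCLM.hasDerivAt (x := t)).mul_const w
    exact (hd.comp t hl).sub_const _
  have hB : ∀ t ∈ Icc s 1, HasDerivAt
      (fun t : ℝ => Real.log (1 - s * ‖w‖) - Real.log (1 - t * ‖w‖))
      (‖w‖ / (1 - t * ‖w‖)) t := by
    intro t ht
    have hne : 1 - t * ‖w‖ ≠ 0 := by nlinarith [ht.1, ht.2]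
    have h := ((((hasDerivAt_id t).mul_const ‖w‖).const_sub 1).log hne).const_sub
      (Real.log (1 - s * ‖w‖))
    refine h.congr_deriv ?_
    simp [neg_div]
  have key := image_norm_le_of_norm_deriv_right_le_deriv_boundary'
    (f := fun t : ℝ => f (t * w) - f (s * w)) (a := s) (b := 1)
    (f' := fun t => deriv f (t * w) * w)
    (B := fun t => Real.log (1 - s * ‖w‖) - Real.log (1 - t * ‖w‖))
    (B' := fun t => ‖w‖ / (1 - t * ‖w‖))
    (fun t ht => (hg t ht).continuousAt.continuousWithinAt)
    (fun t ht => (hg t (Ico_subset_Icc_self ht)).hasDerivWithinAt)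
    (by simp)
    (fun t ht => (hB t ht).continuousAt.continuousWithinAt)
    (fun t ht => (hB t (Ico_subset_Icc_self ht)).hasDerivWithinAt)
    (by
      intro t ht
      obtain ⟨hm, he⟩ := hmem t (hs0.trans ht.1) ht.2.le
      have := hf.norm_deriv_le h1 hm
      rw [he] at this
      rw [norm_mul]
      calc _ ≤ 1 / (1 - t * ‖w‖) * ‖w‖ := mul_le_mul_of_nonneg_right this hw0
        _ = _ := by ring)
    (right_mem_Icc.2 hs1)
  simpa using key

lemma MemBloch.dilate {f : ℂ → ℂ} (hf : MemBloch 1 f) {s : ℝ} (hs0 : 0 ≤ s) (hs1 : s ≤ 1) :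
    MemBloch 1 (fun z => f (s * z)) ∧ blochNorm 1 (fun z => f (s * z)) ≤ blochNorm 1 f := by
  have hmem : ∀ z ∈ unitDisk, (s : ℂ) * z ∈ unitDisk ∧ ‖(s : ℂ) * z‖ ≤ ‖z‖ := by
    intro z hz
    have e : ‖(s : ℂ) * z‖ ≤ ‖z‖ := by
      simp only [norm_mul, Complex.norm_real, Real.norm_eq_abs, abs_of_nonneg hs0]
      nlinarith [norm_nonneg z]
    refine ⟨?_, e⟩
    simpa [unitDisk] using e.trans_lt (norm_lt_one_of_mem hz)
  have hder : ∀ z ∈ unitDisk, HasDerivAt (fun z => f (s * z)) (deriv f (s * z) * s) z := by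
    intro z hz
    have hl : HasDerivAt (fun z : ℂ => (s : ℂ) * z) s z := by
      simpa using (hasDerivAt_id z).const_mul (s : ℂ)
    exact (hf.differentiableAt (hmem z hz).1).hasDerivAt.comp z hl
  have h := memBloch_and_blochNorm_le (f := fun z => f (s * z)) (C := wnorm 1 (deriv f))
    (fun z hz => (hder z hz).differentiableAt.differentiableWithinAt) (by
      intro z hz
      obtain ⟨hm, he⟩ := hmem z hz
      rw [(hder z hz).deriv, norm_mul]
      refine le_trans ?_ (hf.weight_mul_deriv_le hm)
      have h1 : ‖(s : ℂ)‖ ≤ 1 := by simpa [abs_of_nonneg hs0] using hs1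
      have h2 : ‖deriv f (s * z)‖ * ‖(s : ℂ)‖ ≤ ‖deriv f (s * z)‖ :=
        mul_le_of_le_one_right (norm_nonneg _) h1
      have h3 : 1 - ‖z‖ ^ 2 ≤ 1 - ‖(s : ℂ) * z‖ ^ 2 := by gcongr
      exact mul_le_mul h3 h2 (by positivity)
        (one_sub_sq_pos (norm_nonneg _) (norm_lt_one_of_mem hm)).le)
  refine ⟨h.1, ?_⟩
  simpa [blochNorm] using h.2

lemma memBloch_linComb {f g : ℂ → ℂ} (hf : MemBloch 1 f) (hg : MemBloch 1 g) (a b : ℂ) :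
    MemBloch 1 (fun z => a * f z + b * g z) ∧
      blochNorm 1 (fun z => a * f z + b * g z) ≤ ‖a‖ * blochNorm 1 f + ‖b‖ * blochNorm 1 g := by
  have hder : ∀ z ∈ unitDisk, HasDerivAt (fun z => a * f z + b * g z)
      (a * deriv f z + b * deriv g z) z := fun z hz =>
    ((hf.differentiableAt hz).hasDerivAt.const_mul a).add
      ((hg.differentiableAt hz).hasDerivAt.const_mul b)
  have h := memBloch_and_blochNorm_le (f := fun z => a * f z + b * g z)
    (C := ‖a‖ * wnorm 1 (deriv f) + ‖b‖ * wnorm 1 (deriv g))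
    (fun z hz => (hder z hz).differentiableAt.differentiableWithinAt) (by
      intro z hz
      rw [(hder z hz).deriv]
      have hw := (one_sub_sq_pos (norm_nonneg _) (norm_lt_one_of_mem hz)).le
      calc (1 - ‖z‖ ^ 2) * ‖a * deriv f z + b * deriv g z‖
          ≤ (1 - ‖z‖ ^ 2) * (‖a‖ * ‖deriv f z‖ + ‖b‖ * ‖deriv g z‖) := by
            refine mul_le_mul_of_nonneg_left ?_ hw
            simpa using norm_add_le (a * deriv f z) (b * deriv g z)
        _ = ‖a‖ * ((1 - ‖z‖ ^ 2) * ‖deriv f z‖) + ‖b‖ * ((1 - ‖z‖ ^ 2) * ‖deriv g z‖) := by ring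
        _ ≤ _ := add_le_add
            (mul_le_mul_of_nonneg_left (hf.weight_mul_deriv_le hz) (norm_nonneg _))
            (mul_le_mul_of_nonneg_left (hg.weight_mul_deriv_le hz) (norm_nonneg _)))
  refine ⟨h.1, h.2.trans ?_⟩
  have h0 := norm_add_le (a * f 0) (b * g 0)
  simp only [norm_mul] at h0
  simp only [blochNorm]
  linarith

/-- The logarithmic test function `z ↦ ½ log (1 / (1 - ā z))`. -/
def logTest (a : ℂ) (z : ℂ) : ℂ := -Complex.log (1 - (starRingEnd ℂ) a * z) / 2

lemma norm_conj_mul_lt {a z : ℂ} (ha : a ∈ unitDisk) (hz : z ∈ unitDisk) :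
    ‖(starRingEnd ℂ) a * z‖ ≤ ‖a‖ ∧ ‖(starRingEnd ℂ) a * z‖ ≤ ‖z‖ := by
  have h1 := norm_lt_one_of_mem ha
  have h2 := norm_lt_one_of_mem hz
  rw [norm_mul, RCLike.norm_conj]
  constructor <;> nlinarith [norm_nonneg a, norm_nonneg z]

lemma logTest_bloch {a : ℂ} (ha : a ∈ unitDisk) :
    MemBloch 1 (logTest a) ∧ blochNorm 1 (logTest a) ≤ 1 := by
  have hder : ∀ z ∈ unitDisk, HasDerivAt (logTest a)
      ((starRingEnd ℂ) a / (1 - (starRingEnd ℂ) a * z) / 2) z := by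
    intro z hz
    have hlt : ‖(starRingEnd ℂ) a * z‖ < 1 :=
      (norm_conj_mul_lt ha hz).1.trans_lt (norm_lt_one_of_mem ha)
    have hs : 1 - (starRingEnd ℂ) a * z ∈ slitPlane := by
      left
      have := (Complex.re_le_norm ((starRingEnd ℂ) a * z))
      rw [Complex.sub_re, Complex.one_re]
      linarith
    have h := ((((hasDerivAt_id z).const_mul ((starRingEnd ℂ) a)).const_sub 1).clog
      hs).neg.div_const 2
    refine h.congr_deriv ?_
    simp [neg_div]
  have h := memBloch_and_blochNorm_le (f := logTest a) (C := 1)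
    (fun z hz => (hder z hz).differentiableAt.differentiableWithinAt) (by
      intro z hz
      have hz1 := norm_lt_one_of_mem hz
      have ha1 := norm_lt_one_of_mem ha
      have hlow : 1 - ‖z‖ ≤ ‖1 - (starRingEnd ℂ) a * z‖ := by
        have := norm_sub_norm_le 1 ((starRingEnd ℂ) a * z)
        rw [norm_one] at this
        linarith [(norm_conj_mul_lt ha hz).2]
      rw [(hder z hz).deriv, norm_div, norm_div, RCLike.norm_conj, Complex.norm_ofNat]
      have hq : ‖a‖ / ‖1 - (starRingEnd ℂ) a * z‖ ≤ 1 / (1 - ‖z‖) :=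
        div_le_div₀ zero_le_one ha1.le (by linarith) hlow
      calc (1 - ‖z‖ ^ 2) * (‖a‖ / ‖1 - (starRingEnd ℂ) a * z‖ / 2)
          ≤ (1 - ‖z‖ ^ 2) * (1 / (1 - ‖z‖) / 2) := by
            refine mul_le_mul_of_nonneg_left (by linarith)
              (one_sub_sq_pos (norm_nonneg _) hz1).le
        _ = (1 + ‖z‖) / 2 := by
            have : 1 - ‖z‖ ≠ 0 := by linarith
            field_simp
            ring
        _ ≤ 1 := by linarith)
  refine ⟨h.1, h.2.trans ?_⟩
  simp [logTest]

lemma logTest_self {a : ℂ} (ha : a ∈ unitDisk) :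
    ‖logTest a a‖ = -Real.log (1 - ‖a‖ ^ 2) / 2 := by
  have hp := one_sub_sq_pos (norm_nonneg a) (norm_lt_one_of_mem ha)
  have e : 1 - (starRingEnd ℂ) a * a = ((1 - ‖a‖ ^ 2 : ℝ) : ℂ) := by
    rw [mul_comm, Complex.mul_conj, Complex.normSq_eq_norm_sq]
    push_cast
    ring
  have hl : Real.log (1 - ‖a‖ ^ 2) ≤ 0 :=
    Real.log_nonpos hp.le (by nlinarith [norm_nonneg a])
  rw [logTest, e, ← Complex.ofReal_log hp.le, norm_div, norm_neg, Complex.norm_real,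
    Real.norm_eq_abs, abs_of_nonpos hl, Complex.norm_ofNat]

lemma logTest_bounded {a : ℂ} (ha : a ∈ unitDisk) :
    ∃ B, 0 ≤ B ∧ ∀ z ∈ unitDisk, ‖logTest a z‖ ≤ B := by
  have ha1 := norm_lt_one_of_mem ha
  have hl : Real.log (1 - ‖a‖) ≤ 0 := Real.log_nonpos (by linarith) (by linarith [norm_nonneg a])
  refine ⟨(Real.log 2 - Real.log (1 - ‖a‖) + Real.pi) / 2, ?_, fun z hz => ?_⟩
  · have := Real.pi_pos
    have := Real.log_nonneg (one_le_two (α := ℝ))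
    linarith
  set q := 1 - (starRingEnd ℂ) a * z
  have hn := norm_conj_mul_lt ha hz
  have hlow : 1 - ‖a‖ ≤ ‖q‖ := by
    have := norm_sub_norm_le 1 ((starRingEnd ℂ) a * z)
    rw [norm_one] at this
    linarith
  have hup : ‖q‖ ≤ 2 := by
    have := norm_sub_le 1 ((starRingEnd ℂ) a * z)
    rw [norm_one] at this
    linarith
  have h1 : Real.log (1 - ‖a‖) ≤ Real.log ‖q‖ := Real.log_le_log (by linarith) hlow
  have h2 : Real.log ‖q‖ ≤ Real.log 2 := Real.log_le_log (by linarith) hup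
  have h3 : |Real.log ‖q‖| ≤ Real.log 2 - Real.log (1 - ‖a‖) := by
    have := Real.log_nonneg (one_le_two (α := ℝ))
    rw [abs_le]
    constructor <;> linarith
  have h4 := Complex.norm_le_abs_re_add_abs_im (Complex.log q)
  rw [Complex.log_re, Complex.log_im] at h4
  have h5 := Complex.abs_arg_le_pi q
  rw [logTest, norm_div, norm_neg, Complex.norm_ofNat]
  linarith

lemma pow_mul_log_le {r : ℝ} (h0 : 0 ≤ r) (h1 : r < 1) (n : ℕ) :
    r ^ n * Real.log n ≤ 2 - Real.log (1 - r ^ 2) := by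
  have hp := one_sub_sq_pos h0 h1
  have hl : Real.log (1 - r ^ 2) ≤ 0 := Real.log_nonpos hp.le (by nlinarith)
  rcases Nat.eq_zero_or_pos n with rfl | hn
  · simp
    linarith
  have hn' : (0 : ℝ) < n := by exact_mod_cast hn
  have hr : 0 < 1 - r := by linarith
  have hlog1 : Real.log (1 - r) ≤ 0 := Real.log_nonpos hr.le (by linarith)
  set x := n * (1 - r) with hx
  have hxp : 0 < x := by positivity
  have e1 : Real.log n = Real.log x - Real.log (1 - r) := by
    rw [hx, Real.log_mul hn'.ne' hr.ne']
    ring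
  have hpow : r ^ n ≤ Real.exp (-x) := by
    calc r ^ n ≤ (Real.exp (-(1 - r))) ^ n := by
          refine pow_le_pow_left₀ h0 ?_ n
          have := Real.add_one_le_exp (-(1 - r))
          linarith
      _ = Real.exp (-x) := by
          rw [← Real.exp_nat_mul]
          congr 1
          rw [hx]
          ring
  have hpow1 : r ^ n ≤ 1 := pow_le_one₀ h0 h1.le
  have hpow0 : 0 ≤ r ^ n := pow_nonneg h0 n
  have hlx : Real.log x ≤ Real.exp x := by
    have := Real.log_le_sub_one_of_pos hxp
    have := Real.add_one_le_exp x
    linarith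
  have hA : r ^ n * Real.log x ≤ 1 := by
    calc r ^ n * Real.log x ≤ r ^ n * Real.exp x := mul_le_mul_of_nonneg_left hlx hpow0
      _ ≤ Real.exp (-x) * Real.exp x := mul_le_mul_of_nonneg_right hpow (Real.exp_pos x).le
      _ = 1 := by rw [← Real.exp_add]; simp
  have hB : r ^ n * -Real.log (1 - r) ≤ -Real.log (1 - r) :=
    mul_le_of_le_one_left (by linarith) hpow1
  have hC : Real.log (1 - r ^ 2) ≤ 1 + Real.log (1 - r) := by
    have e : 1 - r ^ 2 = (1 + r) * (1 - r) := by ring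
    rw [e, Real.log_mul (by linarith) hr.ne']
    have := Real.log_le_sub_one_of_pos (show 0 < 1 + r by linarith)
    linarith
  rw [e1]
  nlinarith

lemma exp_neg_three_le_pow {r : ℝ} (h0 : 1 / 2 ≤ r) (h1 : r < 1) :
    Real.exp (-3) ≤ r ^ ⌈1 / (1 - r)⌉₊ := by
  have hr : 0 < 1 - r := by linarith
  have hr0 : 0 < r := by linarith
  set n := ⌈1 / (1 - r)⌉₊ with hn
  have hn1 : (n : ℝ) < 1 / (1 - r) + 1 := Nat.ceil_lt_add_one (by positivity)
  have hlog : -(2 * (1 - r)) ≤ Real.log r := by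
    have h := Real.one_sub_inv_le_log_of_pos hr0
    have : r⁻¹ ≤ 1 + 2 * (1 - r) := by
      rw [inv_le_iff_one_le_mul₀ hr0]
      nlinarith
    linarith
  have h2 : (n : ℝ) * (1 - r) ≤ 1 + (1 - r) := by
    have := mul_le_mul_of_nonneg_right hn1.le hr.le
    rwa [add_mul, div_mul_cancel₀ _ hr.ne', one_mul] at this
  rw [← Real.exp_log hr0, ← Real.exp_nat_mul, Real.exp_le_exp]
  have := mul_le_mul_of_nonneg_left hlog (Nat.cast_nonneg (α := ℝ) n)
  nlinarith

lemma MemWeighted.sub {β : ℝ} {g h : ℂ → ℂ} (hg : MemWeighted β g) (hh : MemWeighted β h) :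
    MemWeighted β (fun z => g z - h z) ∧ wnorm β (fun z => g z - h z) ≤ wnorm β g + wnorm β h := by
  have key : ∀ z ∈ unitDisk, (1 - ‖z‖ ^ 2) ^ β * ‖g z - h z‖ ≤ wnorm β g + wnorm β h := by
    intro z hz
    calc (1 - ‖z‖ ^ 2) ^ β * ‖g z - h z‖
        ≤ (1 - ‖z‖ ^ 2) ^ β * (‖g z‖ + ‖h z‖) :=
          mul_le_mul_of_nonneg_left (norm_sub_le _ _) (weight_nonneg β hz)
      _ = (1 - ‖z‖ ^ 2) ^ β * ‖g z‖ + (1 - ‖z‖ ^ 2) ^ β * ‖h z‖ := by ring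
      _ ≤ _ := add_le_add (le_wnorm hg hz) (le_wnorm hh hz)
  refine ⟨⟨hg.1.sub hh.1, wnorm β g + wnorm β h, ?_⟩, wnorm_le key⟩
  rintro _ ⟨z, hz, rfl⟩
  exact key z hz

/-- The dilates `f (s ·)` of the unit ball of the Bloch space form a totally bounded set for the
sup norm on the disk. -/
lemma exists_finite_net_dilate {s : ℝ} (hs0 : 0 ≤ s) (hs1 : s < 1) {ε : ℝ} (hε : 0 < ε) :
    ∃ T : Finset (ℂ → ℂ), (∀ g ∈ T, MemBloch 1 g) ∧
      ∀ f, MemBloch 1 f → blochNorm 1 f ≤ 1 →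
        ∃ g ∈ T, ∀ z ∈ unitDisk, ‖f (s * z) - g (s * z)‖ ≤ ε := by
  classical
  let X := Metric.closedBall (0 : ℂ) s
  have hX : ∀ x ∈ X, ‖x‖ ≤ s := fun x hx => by simpa [X] using hx
  have hXD : ∀ x ∈ X, x ∈ unitDisk := fun x hx => by
    simpa [unitDisk] using (hX x hx).trans_lt hs1
  have : CompactSpace X := isCompact_iff_compactSpace.1 (isCompact_closedBall (0 : ℂ) s)
  let ι := {f : ℂ → ℂ // MemBloch 1 f ∧ blochNorm 1 f ≤ 1}
  have hcont : ∀ f : ι, Continuous (fun x : X => f.1 x) := fun f =>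
    (f.2.1.1.continuousOn.mono hXD).domRestrict
  let F : ι → BoundedContinuousFunction X ℂ := fun f =>
    BoundedContinuousFunction.mkOfCompact ⟨_, hcont f⟩
  have hF : ∀ (f : ι) (x : X), F f x = f.1 x := fun f x => rfl
  have hcomp : IsCompact (closure (range F)) := by
    refine BoundedContinuousFunction.arzela_ascoli
      (Metric.closedBall (0 : ℂ) (1 - Real.log (1 - s))) (isCompact_closedBall _ _) _ ?_ ?_
    · rintro _ x ⟨f, rfl⟩
      have hx := x.2
      have h1 := f.2.1.norm_sub_le f.2.2 (hXD x hx) le_rfl zero_le_one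
      simp only [Complex.ofReal_zero, zero_mul, sub_zero, Real.log_one, zero_sub] at h1
      have h2 : Real.log (1 - s) ≤ Real.log (1 - ‖(x : ℂ)‖) :=
        Real.log_le_log (by linarith) (by linarith [hX x hx])
      have h3 := MemBloch.norm_zero_le f.2.2
      have h4 := norm_sub_norm_le (f.1 x) (f.1 0)
      rw [mem_closedBall_zero_iff, hF]
      linarith
    · refine Metric.equicontinuous_of_continuity_modulus (fun t => 1 / (1 - s) * t) ?_ _ ?_
      · have : Continuous (fun t : ℝ => 1 / (1 - s) * t) := by fun_prop
        simpa using this.tendsto 0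
      · rintro x y ⟨_, f, rfl⟩
        change dist (F f x) (F f y) ≤ _
        rw [hF, hF, Subtype.dist_eq, dist_eq_norm, dist_eq_norm]
        refine Convex.norm_image_sub_le_of_norm_deriv_le (s := X)
          (fun w hw => f.2.1.differentiableAt (hXD w hw)) (fun w hw => ?_)
          (convex_closedBall _ _) y.2 x.2
        refine (f.2.1.norm_deriv_le f.2.2 (hXD w hw)).trans ?_
        exact one_div_le_one_div_of_le (by linarith) (by linarith [hX w hw])
  obtain ⟨t, ht, htf, hcov⟩ := Metric.finite_approx_of_totallyBounded
    (hcomp.totallyBounded.subset subset_closure) ε hε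
  obtain ⟨t', ht'f, rfl⟩ : ∃ t' : Set ι, t'.Finite ∧ F '' t' = t := by
    rw [← Set.image_univ] at ht
    obtain ⟨t', -, h1, h2⟩ := Set.exists_subset_image_finite_and.1 ⟨t, ht, htf, rfl⟩
    exact ⟨t', h1, h2.symm⟩
  refine ⟨ht'f.toFinset.image Subtype.val, ?_, fun f hf hf1 => ?_⟩
  · intro g hg
    obtain ⟨g, -, rfl⟩ := Finset.mem_image.1 hg
    exact g.2.1
  · have := hcov ⟨⟨f, hf, hf1⟩, rfl⟩
    simp only [mem_iUnion, Set.exists_mem_image, Metric.mem_ball, exists_prop] at this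
    obtain ⟨g, hg, hd⟩ := this
    refine ⟨g, Finset.mem_image_of_mem _ (by simpa using hg), fun z hz => ?_⟩
    have hz' : (s : ℂ) * z ∈ X := by
      simp only [X, mem_closedBall_zero_iff, norm_mul, Complex.norm_real, Real.norm_eq_abs,
        abs_of_nonneg hs0]
      exact mul_le_of_le_one_right hs0 (norm_lt_one_of_mem hz).le
    have := (BoundedContinuousFunction.dist_coe_le_dist (f := F ⟨f, hf, hf1⟩) (g := F g)
      ⟨_, hz'⟩).trans hd.le
    simpa [hF, dist_eq_norm] using this

section Operator

variable {β : ℝ} {u φ : ℂ → ℂ}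

lemma BoundedBlochToWeighted.exists_log_bound (hφ : MapsTo φ unitDisk unitDisk)
    (hb : BoundedBlochToWeighted 1 β u φ) :
    ∃ D, 0 < D ∧ ∀ z ∈ unitDisk,
      (1 - ‖z‖ ^ 2) ^ β * ‖u z‖ * (2 - Real.log (1 - ‖φ z‖ ^ 2)) ≤ D := by
  obtain ⟨hm, C, hC, hbd⟩ := hb
  have h1 : MemBloch 1 (fun _ => 1) :=
    (memBloch_and_blochNorm_le (C := 0) (differentiableOn_const _) (by simp)).1
  have hM := wnorm_nonneg β (wcomp u φ fun _ => 1)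
  refine ⟨2 * wnorm β (wcomp u φ fun _ => 1) + 2 * C, by positivity, fun z hz => ?_⟩
  have hu := le_wnorm (hm _ h1) hz
  obtain ⟨hl, hl1⟩ := logTest_bloch (hφ hz)
  have hlog := (le_wnorm (hm _ hl) hz).trans (hbd _ hl)
  simp only [wcomp, mul_one, norm_mul, logTest_self (hφ hz)] at hu hlog ⊢
  have : C * blochNorm 1 (logTest (φ z)) ≤ C := mul_le_of_le_one_right hC.le hl1
  linarith

lemma neg_log_one_sub_sq_nonneg {z : ℂ} (hz : z ∈ unitDisk) : 0 ≤ -Real.log (1 - ‖z‖ ^ 2) := by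
  have := Real.log_nonpos (one_sub_sq_pos (norm_nonneg z) (norm_lt_one_of_mem hz)).le
    (by nlinarith [norm_nonneg z])
  linarith

lemma log_mul_weight_pow_le (hφ : MapsTo φ unitDisk unitDisk) {D : ℝ}
    (hD : ∀ z ∈ unitDisk, (1 - ‖z‖ ^ 2) ^ β * ‖u z‖ * (2 - Real.log (1 - ‖φ z‖ ^ 2)) ≤ D)
    (n : ℕ) {z : ℂ} (hz : z ∈ unitDisk) :
    Real.log n * ((1 - ‖z‖ ^ 2) ^ β * ‖u z * φ z ^ n‖) ≤ D := by
  refine le_trans ?_ (hD z hz)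
  have h := pow_mul_log_le (norm_nonneg (φ z)) (norm_lt_one_of_mem (hφ hz)) n
  have hw := mul_nonneg (weight_nonneg β hz) (norm_nonneg (u z))
  rw [norm_mul, norm_pow]
  calc _ = (1 - ‖z‖ ^ 2) ^ β * ‖u z‖ * (‖φ z‖ ^ n * Real.log n) := by ring
    _ ≤ _ := mul_le_mul_of_nonneg_left h hw

lemma log_mul_wnorm_pow_le {a : ℝ} (n : ℕ) (ha : 0 ≤ a)
    (h : ∀ z ∈ unitDisk, Real.log n * ((1 - ‖z‖ ^ 2) ^ β * ‖u z * φ z ^ n‖) ≤ a) :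
    Real.log n * wnorm β (fun z => u z * φ z ^ n) ≤ a := by
  rcases (Real.log_natCast_nonneg n).eq_or_lt with h0 | h0
  · rw [← h0, zero_mul]
    exact ha
  · rw [← le_div_iff₀' h0]
    exact wnorm_le fun z hz => (le_div_iff₀' h0).2 (h z hz)

lemma isCompactOpToWeighted_dilate (hφ : MapsTo φ unitDisk unitDisk)
    (hb : BoundedBlochToWeighted 1 β u φ) {s : ℝ} (hs0 : 0 ≤ s) (hs1 : s < 1) :
    IsCompactOpToWeighted 1 β (fun f => wcomp u φ fun z => f (s * z)) := by
  obtain ⟨D, hD0, hD⟩ := hb.exists_log_bound hφ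
  obtain ⟨hm, C, hC, hbd⟩ := hb
  refine ⟨fun f g _ _ a b => ?_, fun f hf => hm _ (hf.dilate hs0 hs1.le).1, ⟨C, fun f hf => ?_⟩, ?_⟩
  · funext z
    simp only [wcomp]
    ring
  · have h := hf.dilate hs0 hs1.le
    exact (hbd _ h.1).trans (mul_le_mul_of_nonneg_left h.2 hC.le)
  · intro ε hε
    classical
    obtain ⟨T, hT, hnet⟩ := exists_finite_net_dilate hs0 hs1 (div_pos hε hD0)
    refine ⟨T.image fun g => wcomp u φ fun z => g (s * z), ?_, fun f hf hf1 => ?_⟩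
    · intro g hg
      obtain ⟨g', hg', rfl⟩ := Finset.mem_image.1 hg
      exact hm _ ((hT g' hg').dilate hs0 hs1.le).1
    · obtain ⟨g, hg, hfg⟩ := hnet f hf hf1
      refine ⟨_, Finset.mem_image_of_mem _ hg, wnorm_le fun z hz => ?_⟩
      have hw := mul_nonneg (weight_nonneg β hz) (norm_nonneg (u z))
      have h1 := hD z hz
      have h2 := neg_log_one_sub_sq_nonneg (hφ hz)
      simp only [wcomp]
      rw [← mul_sub, norm_mul, ← mul_assoc]
      calc _ ≤ D * (ε / D) := mul_le_mul (by nlinarith) (hfg _ (hφ hz)) (norm_nonneg _) hD0.le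
        _ = ε := mul_div_cancel₀ _ hD0.ne'

lemma wnorm_wcomp_sub_le (hb : BoundedBlochToWeighted 1 β u φ) {K : (ℂ → ℂ) → ℂ → ℂ}
    (hK : IsCompactOpToWeighted 1 β K) {f : ℂ → ℂ} (hf : MemBloch 1 f)
    (hf1 : blochNorm 1 f ≤ 1) :
    wnorm β (fun z => wcomp u φ f z - K f z) ≤
      sSup {s | ∃ f, MemBloch 1 f ∧ blochNorm 1 f ≤ 1 ∧
        s = wnorm β (fun z => wcomp u φ f z - K f z)} := by
  obtain ⟨hm, C, hC, hbd⟩ := hb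
  obtain ⟨-, hKm, ⟨C', hKb⟩, -⟩ := hK
  refine le_csSup ⟨C + |C'|, ?_⟩ ⟨f, hf, hf1, rfl⟩
  rintro _ ⟨g, hg, hg1, rfl⟩
  refine ((hm g hg).sub (hKm g hg)).2.trans (add_le_add ?_ ?_)
  · exact (hbd g hg).trans (mul_le_of_le_one_right hC.le hg1)
  · have h0 : 0 ≤ blochNorm 1 g := add_nonneg (norm_nonneg _) (wnorm_nonneg _ _)
    calc _ ≤ C' * blochNorm 1 g := hKb g hg
      _ ≤ |C'| * blochNorm 1 g := mul_le_mul_of_nonneg_right (le_abs_self _) h0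
      _ ≤ |C'| := mul_le_of_le_one_right (abs_nonneg _) hg1

lemma le_sSup_of_compact (hφ : MapsTo φ unitDisk unitDisk)
    (hb : BoundedBlochToWeighted 1 β u φ) {K : (ℂ → ℂ) → ℂ → ℂ}
    (hK : IsCompactOpToWeighted 1 β K) {l : ℝ}
    (hl : ∀ R : ℝ, ∃ z ∈ unitDisk, R ≤ -Real.log (1 - ‖φ z‖ ^ 2) ∧
      l ≤ (1 - ‖z‖ ^ 2) ^ β * ‖u z‖ * -Real.log (1 - ‖φ z‖ ^ 2)) :
    l / 4 ≤ sSup {s | ∃ f, MemBloch 1 f ∧ blochNorm 1 f ≤ 1 ∧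
        s = wnorm β (fun z => wcomp u φ f z - K f z)} := by
  obtain ⟨D, hD0, hD⟩ := hb.exists_log_bound hφ
  refine le_of_forall_pos_le_add fun δ hδ => ?_
  obtain ⟨ε, hε, rfl⟩ : ∃ ε : ℝ, 0 < ε ∧ 2 * ε = δ := ⟨δ / 2, by positivity, by ring⟩
  obtain ⟨T, hT, hnet⟩ := hK.2.2.2 ε hε
  choose z hz hzR hzl using fun k : ℕ => hl k
  have hfk := fun k => logTest_bloch (hφ (hz k))
  choose g hgT hg using fun k => hnet _ (hfk k).1 (hfk k).2
  obtain ⟨⟨g₀, hg₀⟩, hinf⟩ := Finite.exists_infinite_fiber (fun k => (⟨g k, hgT k⟩ : T))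
  rw [Set.infinite_coe_iff] at hinf
  obtain ⟨n, hn⟩ := hinf.nonempty
  obtain ⟨B, hB0, hB⟩ := logTest_bounded (hφ (hz n))
  obtain ⟨m, hm, hmB⟩ := hinf.exists_gt ⌈D * B / ε⌉₊
  have hgn : g n = g₀ := congrArg Subtype.val hn
  have hgm : g m = g₀ := congrArg Subtype.val hm
  have hKn := hg n
  have hKm := hg m
  rw [hgn] at hKn
  rw [hgm] at hKm
  have hself := logTest_self (hφ (hz m))
  have ha := hfk n
  have hb' := hfk m
  generalize logTest (φ (z n)) = a at ha hKn hB
  generalize logTest (φ (z m)) = b at hb' hKm hself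
  have hcomb := memBloch_linComb hb'.1 ha.1 (1 / 2) (-1 / 2)
  have hcomb1 : blochNorm 1 (fun w => 1 / 2 * b w + -1 / 2 * a w) ≤ 1 := by
    refine hcomb.2.trans ?_
    have h1 := hb'.2
    have h2 := ha.2
    norm_num
    linarith
  have hS := wnorm_wcomp_sub_le hb hK hcomb.1 hcomb1
  have hpt := (le_wnorm ((hb.1 _ hcomb.1).sub (hK.2.1 _ hcomb.1)).1 (hz m)).trans hS
  have hKlin := congrFun (hK.1 b a hb'.1 ha.1 (1 / 2) (-1 / 2)) (z m)
  have p1 := (le_wnorm ((hK.2.1 _ hb'.1).sub (hT g₀ hg₀)).1 (hz m)).trans hKm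
  have p2 := (le_wnorm ((hK.2.1 _ ha.1).sub (hT g₀ hg₀)).1 (hz m)).trans hKn
  have hBm := hB _ (hφ (hz m))
  have hDm := hD _ (hz m)
  have hRm := hzR m
  have hlm := hzl m
  have hW := weight_nonneg β (hz m)
  set S := sSup {s | ∃ f, MemBloch 1 f ∧ blochNorm 1 f ≤ 1 ∧
        s = wnorm β (fun z => wcomp u φ f z - K f z)}
  set W := (1 - ‖z m‖ ^ 2) ^ β
  set L := -Real.log (1 - ‖φ (z m)‖ ^ 2)
  simp only [wcomp, hKlin] at hpt
  have hu0 := mul_nonneg hW (norm_nonneg (u (z m)))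
  have hm0 : D * B / ε ≤ m := (Nat.le_ceil _).trans (by exact_mod_cast hmB.le)
  have hmpos : (0 : ℝ) < m := by
    have : 0 < m := (Nat.zero_le _).trans_lt hmB
    exact_mod_cast this
  have hsmall : W * ‖u (z m)‖ * B ≤ ε := by
    have h1 : W * ‖u (z m)‖ * m ≤ D := by nlinarith
    rw [div_le_iff₀ hε] at hm0
    have h2 := mul_le_mul_of_nonneg_right h1 hB0
    by_contra! h3
    nlinarith
  have htri : ‖u (z m)‖ * ‖b (φ (z m))‖ ≤ ‖u (z m)‖ * ‖a (φ (z m))‖ +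
      ‖K b (z m) - g₀ (z m)‖ + ‖K a (z m) - g₀ (z m)‖ +
      2 * ‖u (z m) * (1 / 2 * b (φ (z m)) + -1 / 2 * a (φ (z m))) -
        (1 / 2 * K b (z m) + -1 / 2 * K a (z m))‖ := by
    have e : u (z m) * b (φ (z m)) = u (z m) * a (φ (z m)) +
        (K b (z m) - g₀ (z m)) - (K a (z m) - g₀ (z m)) +
        2 * (u (z m) * (1 / 2 * b (φ (z m)) + -1 / 2 * a (φ (z m))) -
          (1 / 2 * K b (z m) + -1 / 2 * K a (z m))) := by ring
    rw [← norm_mul, e]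
    refine (norm_add_le _ _).trans (add_le_add ((norm_sub_le _ _).trans
      (add_le_add_left ((norm_add_le _ _).trans (by rw [norm_mul])) _)) ?_)
    simp
  have htriW := mul_le_mul_of_nonneg_left htri hW
  have hBu := mul_le_mul_of_nonneg_left hBm hu0
  rw [hself] at htriW
  nlinarith

lemma exists_of_lt_limsup (hφ : MapsTo φ unitDisk unitDisk)
    (hb : BoundedBlochToWeighted 1 β u φ) {l : ℝ} (hl0 : 0 < l)
    (hfreq : ∃ᶠ n : ℕ in atTop, l < Real.log n * wnorm β (fun z => u z * φ z ^ n)) (R : ℝ) :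
    ∃ z ∈ unitDisk, R ≤ -Real.log (1 - ‖φ z‖ ^ 2) ∧
      l / 3 ≤ (1 - ‖z‖ ^ 2) ^ β * ‖u z‖ * -Real.log (1 - ‖φ z‖ ^ 2) := by
  wlog hR : 1 ≤ R generalizing R
  · obtain ⟨z, hz, h1, h2⟩ := this 1 le_rfl
    exact ⟨z, hz, by linarith, h2⟩
  obtain ⟨D, hD0, hD⟩ := hb.exists_log_bound hφ
  have hexp : Real.exp (-R) < 1 := by
    rw [Real.exp_lt_one_iff]
    linarith
  set ρ := Real.sqrt (1 - Real.exp (-R)) with hρ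
  have hρ0 : 0 ≤ ρ := Real.sqrt_nonneg _
  have hρsq : ρ ^ 2 = 1 - Real.exp (-R) := Real.sq_sqrt (by linarith)
  have hρ1 : ρ < 1 := by nlinarith [Real.exp_pos (-R)]
  have hlim : Tendsto (fun n : ℕ => D * (n * ρ ^ n)) atTop (nhds (D * 0)) :=
    (tendsto_self_mul_const_pow_of_lt_one hρ0 hρ1).const_mul D
  rw [mul_zero] at hlim
  obtain ⟨n, hn, hsmall⟩ := (hfreq.and_eventually (hlim.eventually_lt_const hl0)).exists
  obtain ⟨z, hz, hzl⟩ : ∃ z ∈ unitDisk,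
      l < Real.log n * ((1 - ‖z‖ ^ 2) ^ β * ‖u z * φ z ^ n‖) := by
    by_contra! h
    exact absurd (log_mul_wnorm_pow_le n hl0.le h) (not_le.2 hn)
  have hφ0 := norm_nonneg (φ z)
  have hφ1 := norm_lt_one_of_mem (hφ hz)
  have hw := mul_nonneg (weight_nonneg β hz) (norm_nonneg (u z))
  have hL := neg_log_one_sub_sq_nonneg (hφ hz)
  have hDz := hD z hz
  rw [norm_mul, norm_pow] at hzl
  have hRz : R ≤ -Real.log (1 - ‖φ z‖ ^ 2) := by
    by_contra! h
    have h1 : Real.exp (-R) < 1 - ‖φ z‖ ^ 2 := by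
      rw [← Real.lt_log_iff_exp_lt (one_sub_sq_pos hφ0 hφ1)]
      linarith
    have h2 : ‖φ z‖ ≤ ρ := Real.le_sqrt_of_sq_le (by linarith)
    have h3 : ‖φ z‖ ^ n ≤ ρ ^ n := pow_le_pow_left₀ hφ0 h2 n
    have h4 : Real.log n ≤ n := Real.log_le_self (Nat.cast_nonneg n)
    have h5 : Real.log n * ‖φ z‖ ^ n ≤ n * ρ ^ n :=
      mul_le_mul h4 h3 (by positivity) (Nat.cast_nonneg n)
    have h6 : (1 - ‖z‖ ^ 2) ^ β * ‖u z‖ * (Real.log n * ‖φ z‖ ^ n) ≤ D * (n * ρ ^ n) :=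
      mul_le_mul (by nlinarith) h5
        (mul_nonneg (Real.log_natCast_nonneg n) (by positivity)) hD0.le
    linarith
  refine ⟨z, hz, hRz, ?_⟩
  have h := mul_le_mul_of_nonneg_left (pow_mul_log_le hφ0 hφ1 n) hw
  nlinarith

lemma sSup_dilate_le (hφ : MapsTo φ unitDisk unitDisk)
    (hb : BoundedBlochToWeighted 1 β u φ) {A : ℝ}
    (hA : ∀ᶠ n : ℕ in atTop, Real.log n * wnorm β (fun z => u z * φ z ^ n) ≤ A) {δ : ℝ}
    (hδ : 0 < δ) :
    ∃ s : ℝ, 0 ≤ s ∧ s < 1 ∧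
      sSup {t | ∃ f, MemBloch 1 f ∧ blochNorm 1 f ≤ 1 ∧
        t = wnorm β (fun z => wcomp u φ f z - wcomp u φ (fun z => f (s * z)) z)} ≤
      max δ (Real.exp 3 * A) := by
  obtain ⟨D, hD0, hD⟩ := hb.exists_log_bound hφ
  obtain ⟨N, hN⟩ := eventually_atTop.1 hA
  set η : ℝ := 1 / (N + 2) with hη
  have hη0 : 0 < η := by positivity
  have hη1 : η ≤ 1 / 2 := one_div_le_one_div_of_le two_pos (by
    have := Nat.cast_nonneg (α := ℝ) N
    linarith)
  have hq : δ / (D + δ) ≤ 1 := (div_le_one (by positivity)).2 (by linarith)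
  have hq0 : 0 < δ / (D + δ) := by positivity
  refine ⟨1 - η * (δ / (D + δ)), by nlinarith, by nlinarith, ?_⟩
  set s := 1 - η * (δ / (D + δ)) with hs
  have hs0 : 0 ≤ s := by nlinarith
  have hs1 : s ≤ 1 := by nlinarith
  refine Real.sSup_le ?_ (le_max_of_le_left hδ.le)
  rintro _ ⟨f, hf, hf1, rfl⟩
  refine wnorm_le fun z hz => ?_
  have hφ0 := norm_nonneg (φ z)
  have hφ1 := norm_lt_one_of_mem (hφ hz)
  have hw := mul_nonneg (weight_nonneg β hz) (norm_nonneg (u z))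
  have hgrow := hf.norm_sub_le hf1 (hφ hz) hs0 hs1
  simp only [wcomp]
  rw [← mul_sub, norm_mul, ← mul_assoc]
  refine (mul_le_mul_of_nonneg_left hgrow hw).trans ?_
  have hr : 0 < 1 - ‖φ z‖ := by linarith
  rcases le_total ‖φ z‖ (1 - η) with hle | hge
  · refine le_max_of_le_left ?_
    have hsr : 0 < 1 - s * ‖φ z‖ := by nlinarith
    have h1 : Real.log (1 - s * ‖φ z‖) - Real.log (1 - ‖φ z‖) ≤ δ / (D + δ) := by
      rw [← Real.log_div hsr.ne' hr.ne']
      refine (Real.log_le_sub_one_of_pos (div_pos hsr hr)).trans ?_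
      rw [sub_le_iff_le_add, div_le_iff₀ hr]
      have e : 1 - s * ‖φ z‖ = (1 - ‖φ z‖) + η * (δ / (D + δ)) * ‖φ z‖ := by
        rw [hs]
        ring
      rw [e]
      have h2 : η * ‖φ z‖ ≤ 1 - ‖φ z‖ := by nlinarith
      nlinarith
    have h2 : (1 - ‖z‖ ^ 2) ^ β * ‖u z‖ ≤ D := by
      have := hD z hz
      have := neg_log_one_sub_sq_nonneg (hφ hz)
      nlinarith
    calc _ ≤ (1 - ‖z‖ ^ 2) ^ β * ‖u z‖ * (δ / (D + δ)) := mul_le_mul_of_nonneg_left h1 hw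
      _ ≤ D * (δ / (D + δ)) := mul_le_mul_of_nonneg_right h2 hq0.le
      _ ≤ δ := by
        rw [← mul_div_assoc, div_le_iff₀ (by positivity)]
        nlinarith
  · refine le_max_of_le_right ?_
    set n := ⌈1 / (1 - ‖φ z‖)⌉₊ with hn
    have hn1 : 1 / (1 - ‖φ z‖) ≤ n := Nat.le_ceil _
    have hNn : N ≤ n := by
      have h1 : 1 / η ≤ 1 / (1 - ‖φ z‖) := one_div_le_one_div_of_le hr (by linarith)
      rw [hη, one_div_one_div] at h1
      have : (N : ℝ) ≤ n := by linarith
      exact_mod_cast this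
    have hpow := exp_neg_three_le_pow (by linarith) hφ1
    rw [← hn] at hpow
    have hlog : Real.log (1 - s * ‖φ z‖) - Real.log (1 - ‖φ z‖) ≤ Real.log n := by
      have h1 : Real.log (1 - s * ‖φ z‖) ≤ 0 :=
        Real.log_nonpos (by nlinarith) (by nlinarith)
      have h2 := Real.log_le_log (by positivity) hn1
      rw [one_div, Real.log_inv] at h2
      linarith
    have hlogn := Real.log_natCast_nonneg n
    have hone : 1 ≤ Real.exp 3 * ‖φ z‖ ^ n := by
      calc (1 : ℝ) = Real.exp 3 * Real.exp (-3) := by rw [← Real.exp_add]; simp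
        _ ≤ _ := mul_le_mul_of_nonneg_left hpow (Real.exp_pos 3).le
    have hpt : (1 - ‖z‖ ^ 2) ^ β * ‖u z * φ z ^ n‖ ≤ wnorm β (fun z => u z * φ z ^ n) := by
      refine le_wnorm (hb.1 (fun w => w ^ n) ?_) hz
      refine (memBloch_and_blochNorm_le (C := n) (by fun_prop) fun w hw => ?_).1
      have hw1 := norm_lt_one_of_mem hw
      have hw0 := norm_nonneg w
      rw [deriv_pow_field, norm_mul, norm_pow, Complex.norm_natCast]
      have h1 : ‖w‖ ^ (n - 1) ≤ 1 := pow_le_one₀ hw0 hw1.le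
      have h2 : 0 ≤ 1 - ‖w‖ ^ 2 := (one_sub_sq_pos hw0 hw1).le
      calc _ ≤ 1 * ((n : ℝ) * 1) := by
            refine mul_le_mul (by nlinarith) (by gcongr) (by positivity) zero_le_one
        _ = n := by ring
    rw [norm_mul, norm_pow] at hpt
    calc _ ≤ (1 - ‖z‖ ^ 2) ^ β * ‖u z‖ * Real.log n := mul_le_mul_of_nonneg_left hlog hw
      _ ≤ (1 - ‖z‖ ^ 2) ^ β * ‖u z‖ * Real.log n * (Real.exp 3 * ‖φ z‖ ^ n) :=
        le_mul_of_one_le_right (mul_nonneg hw hlogn) hone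
      _ = Real.exp 3 * (Real.log n * ((1 - ‖z‖ ^ 2) ^ β * (‖u z‖ * ‖φ z‖ ^ n))) := by ring
      _ ≤ Real.exp 3 * (Real.log n * wnorm β (fun z => u z * φ z ^ n)) := by gcongr
      _ ≤ Real.exp 3 * A := mul_le_mul_of_nonneg_left (hN n hNn) (Real.exp_pos 3).le

lemma sSup_wnorm_nonneg (K : (ℂ → ℂ) → ℂ → ℂ) :
    0 ≤ sSup {s | ∃ f, MemBloch 1 f ∧ blochNorm 1 f ≤ 1 ∧
      s = wnorm β (fun z => wcomp u φ f z - K f z)} := by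
  refine Real.sSup_nonneg ?_
  rintro _ ⟨f, -, -, rfl⟩
  exact wnorm_nonneg β _

lemma essNormW_le {K : (ℂ → ℂ) → ℂ → ℂ} (hK : IsCompactOpToWeighted 1 β K) :
    essNormW 1 β u φ ≤ sSup {s | ∃ f, MemBloch 1 f ∧ blochNorm 1 f ≤ 1 ∧
      s = wnorm β (fun z => wcomp u φ f z - K f z)} := by
  refine csInf_le ⟨0, ?_⟩ ⟨K, hK, rfl⟩
  rintro _ ⟨K', -, rfl⟩
  exact sSup_wnorm_nonneg K'

end Operator

/-- **Lemma 4.2 (ii)**. `‖uC_φ‖_{e, B → H^∞_ν_β} ≍ limsup_n (log n) ‖uφ^n‖_ν_β`, with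
comparison constants depending only on `β`. -/
theorem essNorm_Bloch_to_weighted_of_eq_one
    (β : ℝ) (hβ : 0 < β) :
    ∃ c C : ℝ, 0 < c ∧ 0 < C ∧
      ∀ u φ : ℂ → ℂ, DifferentiableOn ℂ u unitDisk → DifferentiableOn ℂ φ unitDisk →
        Set.MapsTo φ unitDisk unitDisk → BoundedBlochToWeighted 1 β u φ →
        c * Filter.limsup
              (fun n : ℕ => Real.log n * wnorm β (fun z => u z * φ z ^ n)) Filter.atTop
            ≤ essNormW 1 β u φ ∧
          essNormW 1 β u φ
            ≤ C * Filter.limsup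
                (fun n : ℕ => Real.log n * wnorm β (fun z => u z * φ z ^ n)) Filter.atTop := by
  refine ⟨1 / 12, Real.exp 3, by norm_num, Real.exp_pos 3, fun u φ _ _ hφ hb => ?_⟩
  set v : ℕ → ℝ := fun n => Real.log n * wnorm β (fun z => u z * φ z ^ n)
  obtain ⟨D, hD0, hD⟩ := hb.exists_log_bound hφ
  have hvD : ∀ n, v n ≤ D := fun n =>
    log_mul_wnorm_pow_le n hD0.le fun z hz => log_mul_weight_pow_le hφ hD n hz
  have hv0 : ∀ n, 0 ≤ v n := fun n =>
    mul_nonneg (Real.log_natCast_nonneg n) (wnorm_nonneg β _)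
  have hbdd : IsBoundedUnder (· ≤ ·) atTop v := isBoundedUnder_of ⟨D, hvD⟩
  have hcobdd : IsCoboundedUnder (· ≤ ·) atTop v :=
    (isBoundedUnder_of ⟨0, hv0⟩ : IsBoundedUnder (· ≥ ·) atTop v).isCoboundedUnder_le
  have hlim0 : 0 ≤ limsup v atTop :=
    le_limsup_of_frequently_le (Frequently.of_forall hv0) hbdd
  constructor
  · refine le_csInf ⟨_, _, isCompactOpToWeighted_dilate hφ hb le_rfl zero_lt_one, rfl⟩ ?_
    rintro _ ⟨K, hK, rfl⟩
    rw [← le_div_iff₀' (by norm_num)]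
    refine le_of_forall_lt fun l hl => ?_
    by_contra! hcon
    have hfreq : ∃ l', l < l' ∧ 0 < l' ∧ ∃ᶠ n in atTop, l' < v n := by
      obtain ⟨l', h1, h2⟩ := exists_between hl
      refine ⟨l', h1, ?_, frequently_lt_of_lt_limsup hcobdd h2⟩
      have := div_nonneg (sSup_wnorm_nonneg (β := β) (u := u) (φ := φ) K) (show (0 : ℝ) ≤ 1 / 12 by norm_num)
      linarith
    obtain ⟨l', hll', hl0, hfr⟩ := hfreq
    have := le_sSup_of_compact hφ hb hK (exists_of_lt_limsup hφ hb hl0 hfr)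
    rw [div_le_iff₀ (by norm_num)] at hcon
    linarith
  · refine le_of_forall_pos_le_add fun ε hε => ?_
    have he := Real.exp_pos 3
    have hδ : 0 < ε / Real.exp 3 := by positivity
    have hA : ∀ᶠ n in atTop, v n ≤ limsup v atTop + ε / Real.exp 3 :=
      (eventually_lt_of_limsup_lt (by linarith) hbdd).mono fun _ h => h.le
    obtain ⟨s, hs0, hs1, hs⟩ := sSup_dilate_le hφ hb hA hε
    have hK := isCompactOpToWeighted_dilate hφ hb hs0 hs1
    refine (essNormW_le hK).trans (hs.trans (max_le ?_ ?_))
    · have := mul_nonneg he.le hlim0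
      linarith
    · rw [mul_add, mul_div_cancel₀ _ he.ne']

end
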